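/- (Multi-component model, XXX case.) Let H be a complex vector space, K ≥ 1, and for j = 1, …, K let Tⱼ(λ) = [[Aⱼ(λ),Bⱼ(λ)],[Cⱼ(λ),Dⱼ(λ)]] be monodromy matrices on H with common domain Λ ⊆ ℂ, each satisfying the RTT relation with the rational (XXX-type) R-matrix, such that every matrix entry of Tᵢ(λ) commutes with every matrix entry of Tⱼ(μ) whenever i ≠ j. Suppose there is a nonzero vector |0⟩ ∈ H and scalar functions aⱼ, dⱼ : Λ → ℂ with Aⱼ(λ)|0⟩ = aⱼ(λ)|0⟩, Dⱼ(λ)|0⟩ = dⱼ(λ)|0⟩ and Cⱼ(λ)|0⟩ = 0 for all j and all λ ∈ Λ. Let B(λ) be the (1,2) entry of T(λ) = T₁(λ)T₂(λ)⋯T_K(λ). Then for any pairwise distinct λ₁, …, λ_M ∈ Λ: B(λ₁)⋯B(λ_M)|0⟩ = Σ ( ∏_{1≤i<j≤K} [ ( ∏_{k∈Jⱼ} aᵢ(λ_k) ) ( ∏_{k∈Jᵢ} dⱼ(λ_k) ) ( ∏_{k∈Jᵢ, l∈Jⱼ} f(λ_k,λ_l) ) ] ) ( ∏_{k∈J₁}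 B₁(λ_k) ) ( ∏_{k∈J₂} B₂(λ_k) ) ⋯ ( ∏_{k∈J_K} B_K(λ_k) ) |0⟩, where f(λ,μ) = (λ−μ+1)/(λ−μ), the sum is over all ordered partitions of {1,…,M} into K pairwise disjoint (possibly empty) subsets J₁, …, J_K with J₁ ∪ ⋯ ∪ J_K = {1,…,M}, and within each factor ∏_{k∈Jⱼ} Bⱼ(λ_k) the order is irrelevant since [Bⱼ(λ),Bⱼ(μ)] = 0. -/

import Mathlib

open scoped BigOperators

noncomputable section

/-- The endomorphism algebra of a complex vector space `H`. -/
abbrev EndH (H : Type) [AddCommGroup H] [Module ℂ H] := Module.End ℂ H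

/-- The 4×4 matrix `[[f,0,0,0],[0,1,g,0],[0,g,1,0],[0,0,0,f]]` acting on `ℂ² ⊗ ℂ²`,
indexed by `Fin 2 × Fin 2` (standard tensor basis). -/
def Rfg (f g : ℂ) : Matrix (Fin 2 × Fin 2) (Fin 2 × Fin 2) ℂ :=
  fun p q =>
    if p = q then (if p.1 = p.2 then f else 1)
    else if p.1 = q.2 ∧ p.2 = q.1 then g else 0

/-- Rational function `f(λ,μ) = (λ-μ+1)/(λ-μ)`. -/
def fXXX (l m : ℂ) : ℂ := (l - m + 1) / (l - m)

/-- Rational function `g(λ,μ) = 1/(λ-μ)`. -/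
def gXXX (l m : ℂ) : ℂ := 1 / (l - m)

/-- The rational (XXX-type) R-matrix. -/
def RXXX (l m : ℂ) : Matrix (Fin 2 × Fin 2) (Fin 2 × Fin 2) ℂ := Rfg (fXXX l m) (gXXX l m)

/-- Trigonometric `f(λ,μ) = sinh(λ-μ+η)/sinh(λ-μ)`. -/
def fXXZ (η l m : ℂ) : ℂ := Complex.sinh (l - m + η) / Complex.sinh (l - m)

/-- Trigonometric `g(λ,μ) = sinh η / sinh(λ-μ)`. -/
def gXXZ (η l m : ℂ) : ℂ := Complex.sinh η / Complex.sinh (l - m)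

/-- The trigonometric (XXZ-type) R-matrix with anisotropy `η`. -/
def RXXZ (η l m : ℂ) : Matrix (Fin 2 × Fin 2) (Fin 2 × Fin 2) ℂ :=
  Rfg (fXXZ η l m) (gXXZ η l m)

variable {H : Type} [AddCommGroup H] [Module ℂ H]

/-- `T₁(λ)`: the 2×2 operator matrix `T` acting in the first auxiliary space `ℂ²`
(and in `H`), identity in the second auxiliary space. -/
def aux1 (T : Matrix (Fin 2) (Fin 2) (EndH H)) :
    Matrix (Fin 2 × Fin 2) (Fin 2 × Fin 2) (EndH H) :=
  fun p q => if p.2 = q.2 then T p.1 q.1 else 0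

/-- `T₂(μ)`: the 2×2 operator matrix `T` acting in the second auxiliary space `ℂ²`
(and in `H`), identity in the first auxiliary space. -/
def aux2 (T : Matrix (Fin 2) (Fin 2) (EndH H)) :
    Matrix (Fin 2 × Fin 2) (Fin 2 × Fin 2) (EndH H) :=
  fun p q => if p.1 = q.1 then T p.2 q.2 else 0

/-- A scalar 4×4 matrix viewed as a matrix of endomorphisms of `H`
(i.e. `R ⊗ id_H` on `ℂ² ⊗ ℂ² ⊗ H`). -/
def embedR (R : Matrix (Fin 2 × Fin 2) (Fin 2 × Fin 2) ℂ) :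
    Matrix (Fin 2 × Fin 2) (Fin 2 × Fin 2) (EndH H) :=
  R.map (fun c => c • (1 : EndH H))

/-- The RTT relation `R₁₂(λ,μ) T₁(λ) T₂(μ) = T₂(μ) T₁(λ) R₁₂(λ,μ)` in
`End(ℂ² ⊗ ℂ² ⊗ H)`, for all `λ, μ ∈ Λ` which are admissible (`adm λ μ`). -/
def SatisfiesRTT (Λ : Set ℂ) (adm : ℂ → ℂ → Prop)
    (R : ℂ → ℂ → Matrix (Fin 2 × Fin 2) (Fin 2 × Fin 2) ℂ)
    (T : ℂ → Matrix (Fin 2) (Fin 2) (EndH H)) : Prop :=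
  ∀ lam mu : ℂ, lam ∈ Λ → mu ∈ Λ → adm lam mu →
    embedR (R lam mu) * aux1 (T lam) * aux2 (T mu)
      = aux2 (T mu) * aux1 (T lam) * embedR (R lam mu)

/-- Ordered product `∏_{k ∈ s} B k` of endomorphisms indexed by a finset of a linearly
ordered type, taken in increasing order of the index. -/
def finsetOpProd {ι : Type} [LinearOrder ι] (s : Finset ι) (B : ι → EndH H) : EndH H :=
  ((s.sort (· ≤ ·)).map B).prod

section FinsetOpProd

variable {ι : Type} [LinearOrder ι]

theorem finsetOpProd_empty (B : ι → EndH H) : finsetOpProd ∅ B = 1 := by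
  simp [finsetOpProd]

theorem finsetOpProd_insert {B : ι → EndH H} (hB : ∀ i j, Commute (B i) (B j))
    {s : Finset ι} {m : ι} (hm : m ∉ s) :
    finsetOpProd (insert m s) B = B m * finsetOpProd s B := by
  have hperm : ((insert m s).sort (· ≤ ·)).Perm (m :: s.sort (· ≤ ·)) := by
    rw [← Multiset.coe_eq_coe, ← Multiset.cons_coe, Finset.sort_eq, Finset.sort_eq,
      Finset.insert_val_of_notMem hm]
  unfold finsetOpProd
  rw [(hperm.map B).prod_eq', List.map_cons, List.prod_cons]
  exact List.pairwise_map.2 (List.pairwise_of_forall fun i j => hB i j)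

theorem commute_finsetOpProd {X : EndH H} {B : ι → EndH H} (h : ∀ i, Commute X (B i))
    (s : Finset ι) : Commute X (finsetOpProd s B) := by
  refine Commute.list_prod_right _ _ fun Y hY => ?_
  obtain ⟨i, -, rfl⟩ := List.mem_map.1 hY
  exact h i

theorem finsetOpProd_univ {M : ℕ} (B : Fin M → EndH H) :
    finsetOpProd Finset.univ B = (List.ofFn B).prod := by
  rw [finsetOpProd, Fin.sort_univ, List.ofFn_eq_map]

/-- Action of a diagonal entry of a monodromy matrix on a product of `B` operators applied to
an eigenvector, given the exchange relation between the two. -/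
theorem exchange_finsetOpProd {A B : ι → EndH H} {f g : ι → ι → ℂ}
    (hBB : ∀ i j, Commute (B i) (B j))
    (hAB : ∀ i j, i ≠ j → A i * B j = f j i • (B j * A i) + g i j • (B i * A j))
    (hfg : ∀ i j k, i ≠ j → i ≠ k → j ≠ k → f j i * g i k + g i j * g j k = g i k * f j k)
    {v : H} {α : ι → ℂ} (hv : ∀ i, A i v = α i • v) (s : Finset ι) :
    ∀ m ∉ s, A m (finsetOpProd s B v) =
      (α m * ∏ k ∈ s, f k m) • finsetOpProd s B v +
        ∑ k ∈ s, (g m k * α k * ∏ l ∈ s.erase k, f l k) •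
          B m (finsetOpProd (s.erase k) B v) := by
  induction s using Finset.induction_on with
  | empty => intro m _; simp [finsetOpProd_empty, hv]
  | insert n s hn ih =>
    intro m hm
    rw [Finset.mem_insert, not_or] at hm
    obtain ⟨hmn, hms⟩ := hm
    have hex : ∀ w, A m (B n w) = f n m • B n (A m w) + g m n • B m (A n w) := fun w => by
      simpa using LinearMap.congr_fun (hAB m n hmn) w
    have hcomm : ∀ w, B n (B m w) = B m (B n w) := fun w =>
      LinearMap.congr_fun (hBB n m) w
    have hterm : ∀ k ∈ s, (g m k * α k * ∏ l ∈ (insert n s).erase k, f l k) •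
          B m (finsetOpProd ((insert n s).erase k) B v) =
        f n m • (g m k * α k * ∏ l ∈ s.erase k, f l k) •
          B m (B n (finsetOpProd (s.erase k) B v)) +
        g m n • (g n k * α k * ∏ l ∈ s.erase k, f l k) •
          B m (B n (finsetOpProd (s.erase k) B v)) := by
      intro k hk
      have hnk : n ≠ k := fun h => hn (h ▸ hk)
      have hmk : m ≠ k := fun h => hms (h ▸ hk)
      have hn' : n ∉ s.erase k := fun h => hn (Finset.mem_of_mem_erase h)
      rw [Finset.erase_insert_of_ne hnk, finsetOpProd_insert hBB hn', Finset.prod_insert hn',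
        Module.End.mul_apply, smul_smul, smul_smul, ← add_smul]
      congr 1
      linear_combination (-(α k * ∏ l ∈ s.erase k, f l k)) * hfg m n k hmn hmk hnk
    rw [finsetOpProd_insert hBB hn, Module.End.mul_apply, hex, ih m hms, ih n hn,
      Finset.sum_insert hn, Finset.erase_insert hn, Finset.sum_congr rfl hterm,
      Finset.sum_add_distrib, Finset.prod_insert hn]
    simp only [map_add, map_sum, map_smul, smul_add, Finset.smul_sum, hcomm]
    module

/-- Expansion of the product of `B` operators of a two-component model. -/
theorem finsetOpProd_two_component {A₁ B₁ B₂ D₂ : ι → EndH H} {f g : ι → ι → ℂ}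
    (hB₁ : ∀ i j, Commute (B₁ i) (B₁ j)) (hB₂ : ∀ i j, Commute (B₂ i) (B₂ j))
    (hB : ∀ i j, Commute (A₁ i * B₂ i + B₁ i * D₂ i) (A₁ j * B₂ j + B₁ j * D₂ j))
    (hAB₂ : ∀ i j, Commute (A₁ i) (B₂ j)) (hBB₂ : ∀ i j, Commute (B₁ i) (B₂ j))
    (hBD₂ : ∀ i j, Commute (B₁ i) (D₂ j))
    (hA₁ : ∀ i j, i ≠ j → A₁ i * B₁ j = f j i • (B₁ j * A₁ i) + g i j • (B₁ i * A₁ j))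
    (hD₂ : ∀ i j, i ≠ j → D₂ i * B₂ j = f i j • (B₂ j * D₂ i) + g j i • (B₂ i * D₂ j))
    (hg : ∀ i j, g i j = -g j i)
    (hfg : ∀ i j k, i ≠ j → i ≠ k → j ≠ k → f j i * g i k + g i j * g j k = g i k * f j k)
    (hfg' : ∀ i j k, i ≠ j → i ≠ k → j ≠ k → f i j * g k i + g j i * g k j = g k i * f k j)
    {v : H} {α δ : ι → ℂ} (hα : ∀ i, A₁ i v = α i • v) (hδ : ∀ i, D₂ i v = δ i • v)
    (s : Finset ι) :
    finsetOpProd s (fun i => A₁ i * B₂ i + B₁ i * D₂ i) v =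
      ∑ S ∈ s.powerset,
        ((∏ k ∈ s \ S, α k) * (∏ k ∈ S, δ k) * ∏ k ∈ S, ∏ l ∈ s \ S, f k l) •
          finsetOpProd S B₁ (finsetOpProd (s \ S) B₂ v) := by
  induction s using Finset.induction_on with
  | empty => simp [finsetOpProd_empty]
  | insert m s hm ih =>
    have hactA := exchange_finsetOpProd hB₁ hA₁ hfg hα
    have hactD := exchange_finsetOpProd (f := fun i j => f j i) (g := fun i j => g j i)
      hB₂ hD₂ hfg' hδ
    have swap : ∀ S S' w, finsetOpProd S B₁ (finsetOpProd S' B₂ w) =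
        finsetOpProd S' B₂ (finsetOpProd S B₁ w) := fun S S' w =>
      LinearMap.congr_fun (commute_finsetOpProd
        (fun j => (commute_finsetOpProd (fun i => (hBB₂ i j).symm) S).symm) S') w
    have swapA : ∀ S' w, A₁ m (finsetOpProd S' B₂ w) = finsetOpProd S' B₂ (A₁ m w) :=
      fun S' w => LinearMap.congr_fun (commute_finsetOpProd (hAB₂ m) S') w
    have swapD : ∀ S w, D₂ m (finsetOpProd S B₁ w) = finsetOpProd S B₁ (D₂ m w) :=
      fun S w => LinearMap.congr_fun (commute_finsetOpProd (fun i => (hBD₂ i m).symm) S) w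
    have swapAB : ∀ w, A₁ m (B₂ m w) = B₂ m (A₁ m w) :=
      fun w => LinearMap.congr_fun (hAB₂ m m) w
    have swapB : ∀ S w, B₂ m (finsetOpProd S B₁ w) = finsetOpProd S B₁ (B₂ m w) :=
      fun S w => LinearMap.congr_fun (commute_finsetOpProd (fun i => (hBB₂ i m).symm) S) w
    have swapB' : ∀ S' w, B₁ m (finsetOpProd S' B₂ w) = finsetOpProd S' B₂ (B₁ m w) :=
      fun S' w => LinearMap.congr_fun (commute_finsetOpProd (hBB₂ m) S') w
    have swapBB : ∀ S w, B₁ m (finsetOpProd S B₁ w) = finsetOpProd S B₁ (B₁ m w) :=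
      fun S w => LinearMap.congr_fun (commute_finsetOpProd (hB₁ m) S) w
    set F : Finset ι → Finset ι → ℂ := fun S S' =>
      (∏ k ∈ S', α k) * (∏ k ∈ S, δ k) * ∏ k ∈ S, ∏ l ∈ S', f k l with hF
    set W : Finset ι → Finset ι → H := fun S S' =>
      finsetOpProd S B₁ (finsetOpProd S' B₂ v) with hW
    have hleft : ∀ S ∈ s.powerset, A₁ m (B₂ m (W S (s \ S))) =
        (α m * ∏ k ∈ S, f k m) • W S (insert m (s \ S)) +
        ∑ k ∈ S, (g m k * α k * ∏ l ∈ S.erase k, f l k) •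
          W (insert m (S.erase k)) (insert m (s \ S)) := by
      intro S hS
      have hmS : m ∉ S := fun h => hm (Finset.mem_powerset.1 hS h)
      have hmS' : m ∉ s \ S := fun h => hm (Finset.mem_sdiff.1 h).1
      simp only [hW]
      rw [swapAB, swap, swapA, hactA S m hmS]
      simp only [map_add, map_sum, map_smul]
      congr 1
      · rw [← swap, finsetOpProd_insert hB₂ hmS', Module.End.mul_apply, swapB]
      · refine Finset.sum_congr rfl fun k _ => ?_
        rw [swap, finsetOpProd_insert hB₂ hmS', finsetOpProd_insert hB₁
          (fun h => hmS (Finset.mem_of_mem_erase h)), Module.End.mul_apply, Module.End.mul_apply]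
    have hright : ∀ S ∈ s.powerset, B₁ m (D₂ m (W S (s \ S))) =
        (δ m * ∏ l ∈ s \ S, f m l) • W (insert m S) (s \ S) +
        ∑ k ∈ s \ S, (g k m * δ k * ∏ l ∈ (s \ S).erase k, f k l) •
          W (insert m S) (insert m ((s \ S).erase k)) := by
      intro S hS
      have hmS : m ∉ S := fun h => hm (Finset.mem_powerset.1 hS h)
      have hmS' : m ∉ s \ S := fun h => hm (Finset.mem_sdiff.1 h).1
      simp only [hW]
      rw [swapD, hactD _ m hmS', finsetOpProd_insert hB₁ hmS]
      simp only [map_add, map_sum, map_smul, Module.End.mul_apply]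
      congr 1
      refine Finset.sum_congr rfl fun k _ => ?_
      rw [finsetOpProd_insert hB₂ (fun h => hmS' (Finset.mem_of_mem_erase h)),
        Module.End.mul_apply]
    have hcancel : (∑ S ∈ s.powerset, ∑ k ∈ S,
          (F S (s \ S) * (g m k * α k * ∏ l ∈ S.erase k, f l k)) •
            W (insert m (S.erase k)) (insert m (s \ S))) +
        (∑ S ∈ s.powerset, ∑ k ∈ s \ S,
          (F S (s \ S) * (g k m * δ k * ∏ l ∈ (s \ S).erase k, f k l)) •
            W (insert m S) (insert m ((s \ S).erase k))) = 0 := by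
      rw [add_eq_zero_iff_eq_neg, Finset.sum_sigma', Finset.sum_sigma', ← Finset.sum_neg_distrib]
      refine Finset.sum_bij' (fun p _ => ⟨p.1.erase p.2, p.2⟩) (fun p _ => ⟨insert p.2 p.1, p.2⟩)
        ?_ ?_ ?_ ?_ ?_
      · rintro ⟨S, k⟩ h
        simp only [Finset.mem_sigma, Finset.mem_powerset, Finset.mem_sdiff] at h ⊢
        exact ⟨(Finset.erase_subset _ _).trans h.1, h.1 h.2, Finset.notMem_erase _ _⟩
      · rintro ⟨S, k⟩ h
        simp only [Finset.mem_sigma, Finset.mem_powerset, Finset.mem_sdiff] at h ⊢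
        exact ⟨Finset.insert_subset h.2.1 h.1, Finset.mem_insert_self _ _⟩
      · rintro ⟨S, k⟩ h
        simp only [Finset.mem_sigma] at h
        simp [Finset.insert_erase h.2]
      · rintro ⟨S, k⟩ h
        simp only [Finset.mem_sigma, Finset.mem_sdiff] at h
        simp [Finset.erase_insert h.2.2]
      · rintro ⟨S, k⟩ h
        simp only [Finset.mem_sigma, Finset.mem_powerset] at h
        obtain ⟨hS, hk⟩ := h
        have hk' : k ∉ s \ S := fun h => (Finset.mem_sdiff.1 h).2 hk
        have hsd : s \ S.erase k = insert k (s \ S) := Finset.sdiff_erase (hS hk)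
        simp only [hsd, Finset.erase_insert hk', ← neg_smul]
        congr 1
        simp only [hF]
        rw [← Finset.mul_prod_erase S δ hk,
          ← Finset.mul_prod_erase S (fun k => ∏ l ∈ s \ S, f k l) hk, Finset.prod_insert hk',
          Finset.prod_congr rfl (fun j _ => Finset.prod_insert (f := f j) hk'),
          Finset.prod_mul_distrib, hg m k]
        ring
    have hwantL : ∀ S ∈ s.powerset, F S (s \ S) * (α m * ∏ k ∈ S, f k m) =
        F S (insert m s \ S) := by
      intro S hS
      have hmS : m ∉ S := fun h => hm (Finset.mem_powerset.1 hS h)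
      have hmS' : m ∉ s \ S := fun h => hm (Finset.mem_sdiff.1 h).1
      rw [Finset.insert_sdiff_of_notMem _ hmS]
      simp only [hF]
      rw [Finset.prod_insert hmS',
        Finset.prod_congr rfl (fun j _ => Finset.prod_insert (f := f j) hmS'),
        Finset.prod_mul_distrib]
      ring
    have hwantR : ∀ S ∈ s.powerset, F S (s \ S) * (δ m * ∏ l ∈ s \ S, f m l) =
        F (insert m S) (s \ S) := by
      intro S hS
      have hmS : m ∉ S := fun h => hm (Finset.mem_powerset.1 hS h)
      simp only [hF]
      rw [Finset.prod_insert hmS, Finset.prod_insert hmS]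
      ring
    rw [finsetOpProd_insert hB hm, Module.End.mul_apply, ih, Finset.sum_powerset_insert hm,
      LinearMap.add_apply, Module.End.mul_apply, Module.End.mul_apply]
    simp only [map_sum, map_smul]
    rw [Finset.sum_congr rfl (fun S hS => by rw [hleft S hS]),
      Finset.sum_congr (g := fun S => F S (s \ S) • B₁ m (D₂ m (W S (s \ S)))) rfl
        (fun S hS => rfl),
      Finset.sum_congr (f := fun S => F S (s \ S) • B₁ m (D₂ m (W S (s \ S)))) rfl
        (fun S hS => by rw [hright S hS])]
    simp only [smul_add, Finset.sum_add_distrib, Finset.smul_sum, smul_smul]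
    rw [add_add_add_comm, hcancel, add_zero]
    congr 1
    · refine Finset.sum_congr rfl fun S hS => ?_
      rw [hwantL S hS, Finset.insert_sdiff_of_notMem _
        (fun h => hm (Finset.mem_powerset.1 hS h))]
    · refine Finset.sum_congr rfl fun S hS => ?_
      rw [hwantR S hS]
      have : insert m s \ insert m S = s \ S := by
        ext x
        by_cases hx : x = m
        · subst hx; simp [hm]
        · simp [hx]
      rw [this]

end FinsetOpProd

section Monodromy

/-- A monodromy matrix satisfying the rational RTT relation, together with a highest weight
vector `v` with diagonal eigenvalues `a` and `d`. -/
structure IsHighestWeightXXX (Λ : Set ℂ) (T : ℂ → Matrix (Fin 2) (Fin 2) (EndH H)) (v : H)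
    (a d : ℂ → ℂ) : Prop where
  rtt : SatisfiesRTT Λ (fun l m => l ≠ m) RXXX T
  apply_A : ∀ l ∈ Λ, T l 0 0 v = a l • v
  apply_D : ∀ l ∈ Λ, T l 1 1 v = d l • v
  apply_C : ∀ l ∈ Λ, T l 1 0 v = 0

theorem aux1_mul (T U : Matrix (Fin 2) (Fin 2) (EndH H)) :
    aux1 (T * U) = aux1 T * aux1 U := by
  ext1 ⟨p, q⟩ ⟨r, s⟩
  fin_cases q <;> fin_cases s <;>
    simp [aux1, Matrix.mul_apply, Fintype.sum_prod_type]

theorem aux2_mul (T U : Matrix (Fin 2) (Fin 2) (EndH H)) :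
    aux2 (T * U) = aux2 T * aux2 U := by
  ext1 ⟨p, q⟩ ⟨r, s⟩
  fin_cases p <;> fin_cases r <;>
    simp [aux2, Matrix.mul_apply, Fintype.sum_prod_type]

theorem aux1_one : aux1 (1 : Matrix (Fin 2) (Fin 2) (EndH H)) = 1 := by
  ext1 ⟨p, q⟩ ⟨r, s⟩
  fin_cases p <;> fin_cases q <;> fin_cases r <;> fin_cases s <;> simp [aux1]

theorem aux2_one : aux2 (1 : Matrix (Fin 2) (Fin 2) (EndH H)) = 1 := by
  ext1 ⟨p, q⟩ ⟨r, s⟩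
  fin_cases p <;> fin_cases q <;> fin_cases r <;> fin_cases s <;> simp [aux2]

theorem aux1_commute_aux2 {T U : Matrix (Fin 2) (Fin 2) (EndH H)}
    (h : ∀ i j k l, Commute (T i j) (U k l)) : Commute (aux1 T) (aux2 U) := by
  ext1 ⟨p, q⟩ ⟨r, s⟩
  simp [aux1, aux2, Matrix.mul_apply, Fintype.sum_prod_type, (h _ _ _ _).eq]

theorem SatisfiesRTT.mul {Λ : Set ℂ} {adm : ℂ → ℂ → Prop}
    {R : ℂ → ℂ → Matrix (Fin 2 × Fin 2) (Fin 2 × Fin 2) ℂ}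
    {T U : ℂ → Matrix (Fin 2) (Fin 2) (EndH H)}
    (hT : SatisfiesRTT Λ adm R T) (hU : SatisfiesRTT Λ adm R U)
    (h : ∀ l ∈ Λ, ∀ m ∈ Λ, ∀ i j k n, Commute (T l i j) (U m k n)) :
    SatisfiesRTT Λ adm R (fun l => T l * U l) := by
  intro l m hl hm hlm
  have h₁ := (aux1_commute_aux2 fun i j k n => (h m hm l hl k n i j).symm).eq
  have h₂ := (aux1_commute_aux2 (h l hl m hm)).eq
  have hT' := hT l m hl hm hlm
  have hU' := hU l m hl hm hlm
  simp only [mul_assoc] at hT' hU'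
  simp only [aux1_mul, aux2_mul, mul_assoc]
  rw [← mul_assoc (aux1 (U l)) (aux2 (T m)), h₁]
  calc _ = embedR (R l m) * (aux1 (T l) * aux2 (T m)) * (aux1 (U l) * aux2 (U m)) := by
        simp only [mul_assoc]
    _ = aux2 (T m) * aux1 (T l) * (embedR (R l m) * (aux1 (U l) * aux2 (U m))) := by
        rw [hT']; simp only [mul_assoc]
    _ = aux2 (T m) * (aux1 (T l) * aux2 (U m)) * (aux1 (U l) * embedR (R l m)) := by
        rw [hU']; simp only [mul_assoc]
    _ = _ := by rw [h₂]; simp only [mul_assoc]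

theorem IsHighestWeightXXX.one (Λ : Set ℂ) (v : H) :
    IsHighestWeightXXX Λ (fun _ => 1) v (fun _ => 1) (fun _ => 1) where
  rtt := fun l m _ _ _ => by simp [aux1_one, aux2_one]
  apply_A := by simp
  apply_D := by simp
  apply_C := by simp

theorem IsHighestWeightXXX.mul {Λ : Set ℂ} {T U : ℂ → Matrix (Fin 2) (Fin 2) (EndH H)} {v : H}
    {a d a' d' : ℂ → ℂ} (hT : IsHighestWeightXXX Λ T v a d)
    (hU : IsHighestWeightXXX Λ U v a' d')
    (h : ∀ l ∈ Λ, ∀ m ∈ Λ, ∀ i j k n, Commute (T l i j) (U m k n)) :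
    IsHighestWeightXXX Λ (fun l => T l * U l) v (fun l => a l * a' l) (fun l => d l * d' l) where
  rtt := hT.rtt.mul hU.rtt h
  apply_A := fun l hl => by
    simp [Matrix.mul_apply, hT.apply_A l hl, hU.apply_A l hl, hU.apply_C l hl, smul_smul, mul_comm]
  apply_D := fun l hl => by
    have hc : T l 1 0 (U l 0 1 v) = U l 0 1 (T l 1 0 v) :=
      LinearMap.congr_fun (h l hl l hl 1 0 0 1) v
    simp [Matrix.mul_apply, hc, hT.apply_C l hl, hT.apply_D l hl, hU.apply_D l hl, smul_smul,
      mul_comm]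
  apply_C := fun l hl => by
    simp [Matrix.mul_apply, hT.apply_C l hl, hU.apply_A l hl, hU.apply_C l hl]

theorem commute_ofFn_prod_apply {K : ℕ} {X : EndH H} (T : Fin K → Matrix (Fin 2) (Fin 2) (EndH H))
    (h : ∀ j p q, Commute X (T j p q)) : ∀ p q, Commute X ((List.ofFn T).prod p q) := by
  induction K with
  | zero =>
    intro p q
    by_cases hpq : p = q <;> simp [hpq]
  | succ K ih =>
    intro p q
    rw [List.ofFn_succ, List.prod_cons, Matrix.mul_apply]
    exact Commute.sum_right _ _ _ fun r _ => (h 0 p r).mul_right (ih _ (fun j => h j.succ) r q)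

theorem IsHighestWeightXXX.ofFn_prod {K : ℕ} {Λ : Set ℂ}
    {T : Fin K → ℂ → Matrix (Fin 2) (Fin 2) (EndH H)} {v : H} {a d : Fin K → ℂ → ℂ}
    (hT : ∀ j, IsHighestWeightXXX Λ (T j) v (a j) (d j))
    (hcomm : ∀ i j : Fin K, i ≠ j → ∀ l m : ℂ, l ∈ Λ → m ∈ Λ →
      ∀ p q r s : Fin 2, Commute (T i l p q) (T j m r s)) :
    IsHighestWeightXXX Λ (fun l => (List.ofFn fun j => T j l).prod) v
      (fun l => ∏ j, a j l) (fun l => ∏ j, d j l) := by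
  induction K with
  | zero => simpa using IsHighestWeightXXX.one Λ v
  | succ K ih =>
    simp only [List.ofFn_succ, List.prod_cons, Fin.prod_univ_succ]
    exact (hT 0).mul
      (ih (fun j => hT j.succ) fun i j hij => hcomm _ _ (Fin.succ_injective K |>.ne hij))
      fun l hl m hm i j => commute_ofFn_prod_apply _
        fun k => hcomm 0 k.succ (Fin.succ_ne_zero k).symm l m hl hm i j

theorem SatisfiesRTT.commute_B {Λ : Set ℂ} {T : ℂ → Matrix (Fin 2) (Fin 2) (EndH H)}
    (hT : SatisfiesRTT Λ (fun l m => l ≠ m) RXXX T) {l m : ℂ} (hl : l ∈ Λ) (hm : m ∈ Λ) :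
    Commute (T l 0 1) (T m 0 1) := by
  rcases eq_or_ne l m with rfl | hlm
  · exact Commute.refl _
  have key : ∀ {l m : ℂ}, l ∈ Λ → m ∈ Λ → l ≠ m →
      fXXX l m • (T l 0 1 * T m 0 1) = fXXX l m • (T m 0 1 * T l 0 1) := by
    intro l m hl hm hlm
    simpa [embedR, aux1, aux2, RXXX, Rfg, Matrix.mul_apply, Fintype.sum_prod_type] using
      congrFun (congrFun (hT l m hl hm hlm) (0, 0)) (1, 1)
  rw [Commute, SemiconjBy]
  by_cases hf : fXXX l m = 0
  · have hf' : fXXX m l ≠ 0 := by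
      have hsub : l - m ≠ 0 := sub_ne_zero.2 hlm
      have hsub' : m - l ≠ 0 := sub_ne_zero.2 hlm.symm
      rw [fXXX, div_eq_zero_iff, or_iff_left hsub] at hf
      refine div_ne_zero (fun h => ?_) hsub'
      have : (2 : ℂ) = 0 := by linear_combination hf + h
      norm_num at this
    exact (smul_right_injective _ hf' (key hm hl hlm.symm)).symm
  · exact smul_right_injective _ hf (key hl hm hlm)

theorem gXXX_antisymm (l m : ℂ) : gXXX l m = -gXXX m l := by
  rw [gXXX, gXXX, ← neg_sub m l, div_neg]

theorem fXXX_mul_gXXX_add {l m n : ℂ} (hlm : l ≠ m) (hln : l ≠ n) (hmn : m ≠ n) :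
    fXXX m l * gXXX l n + gXXX l m * gXXX m n = gXXX l n * fXXX m n := by
  have h₁ := sub_ne_zero.2 hlm
  have h₂ := sub_ne_zero.2 hln
  have h₃ := sub_ne_zero.2 hmn
  have h₄ := sub_ne_zero.2 hlm.symm
  simp only [fXXX, gXXX]
  field_simp
  ring

theorem fXXX_mul_gXXX_add' {l m n : ℂ} (hlm : l ≠ m) (hln : l ≠ n) (hmn : m ≠ n) :
    fXXX l m * gXXX n l + gXXX m l * gXXX n m = gXXX n l * fXXX n m := by
  have h₁ := sub_ne_zero.2 hlm
  have h₂ := sub_ne_zero.2 hln.symm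
  have h₃ := sub_ne_zero.2 hmn.symm
  have h₄ := sub_ne_zero.2 hlm.symm
  simp only [fXXX, gXXX]
  field_simp
  ring

theorem SatisfiesRTT.A_mul_B {Λ : Set ℂ} {T : ℂ → Matrix (Fin 2) (Fin 2) (EndH H)}
    (hT : SatisfiesRTT Λ (fun l m => l ≠ m) RXXX T) {l m : ℂ} (hl : l ∈ Λ) (hm : m ∈ Λ)
    (hlm : l ≠ m) :
    T l 0 0 * T m 0 1 = fXXX m l • (T m 0 1 * T l 0 0) + gXXX l m • (T l 0 1 * T m 0 0) := by
  have h : fXXX m l • (T m 0 1 * T l 0 0) =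
      gXXX m l • (T l 0 1 * T m 0 0) + T l 0 0 * T m 0 1 := by
    simpa [embedR, aux1, aux2, RXXX, Rfg, Matrix.mul_apply, Fintype.sum_prod_type, add_comm] using
      congrFun (congrFun (hT m l hm hl hlm.symm) (0, 0)) (1, 0)
  rw [h, gXXX_antisymm l m]
  module

theorem SatisfiesRTT.D_mul_B {Λ : Set ℂ} {T : ℂ → Matrix (Fin 2) (Fin 2) (EndH H)}
    (hT : SatisfiesRTT Λ (fun l m => l ≠ m) RXXX T) {l m : ℂ} (hl : l ∈ Λ) (hm : m ∈ Λ)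
    (hlm : l ≠ m) :
    T l 1 1 * T m 0 1 = fXXX l m • (T m 0 1 * T l 1 1) + gXXX m l • (T l 0 1 * T m 1 1) := by
  have h : gXXX l m • (T l 0 1 * T m 1 1) + T l 1 1 * T m 0 1 =
      fXXX l m • (T m 0 1 * T l 1 1) := by
    simpa [embedR, aux1, aux2, RXXX, Rfg, Matrix.mul_apply, Fintype.sum_prod_type, add_comm] using
      congrFun (congrFun (hT l m hl hm hlm) (1, 0)) (1, 1)
  rw [← h, gXXX_antisymm m l]
  module

end Monodromy

section Partition

variable {ι : Type} [DecidableEq ι]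

/-- `J` is an ordered partition of `s` into possibly empty pairwise disjoint parts. -/
def IsOrderedPartition {K : ℕ} (J : Fin K → Finset ι) (s : Finset ι) : Prop :=
  Pairwise (fun i j => Disjoint (J i) (J j)) ∧ Finset.univ.biUnion J = s

theorem isOrderedPartition_cons {K : ℕ} {S s : Finset ι} {J : Fin K → Finset ι} :
    IsOrderedPartition (Fin.cons S J : Fin (K + 1) → Finset ι) s ↔
      S ⊆ s ∧ IsOrderedPartition J (s \ S) := by
  have hunion : Finset.univ.biUnion (Fin.cons S J : Fin (K + 1) → Finset ι) =
      S ∪ Finset.univ.biUnion J := by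
    ext x
    simp [Fin.exists_fin_succ]
  have hpair : Pairwise (fun i j => Disjoint ((Fin.cons S J : Fin (K + 1) → Finset ι) i)
      ((Fin.cons S J : Fin (K + 1) → Finset ι) j)) ↔
      Disjoint S (Finset.univ.biUnion J) ∧ Pairwise (fun i j => Disjoint (J i) (J j)) := by
    simp only [Pairwise, Fin.forall_fin_succ, Finset.disjoint_biUnion_right]
    simp [Fin.succ_ne_zero, (Fin.succ_ne_zero _).symm, disjoint_comm, forall_and]
  rw [IsOrderedPartition, IsOrderedPartition, hunion, hpair]
  constructor
  · rintro ⟨⟨hd, hp⟩, rfl⟩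
    exact ⟨Finset.subset_union_left, hp, (Finset.union_sdiff_cancel_left hd).symm⟩
  · rintro ⟨hS, hp, hu⟩
    rw [hu]
    exact ⟨⟨Finset.disjoint_sdiff, hp⟩, Finset.union_sdiff_of_subset hS⟩

open Classical in
theorem sum_isOrderedPartition_succ [Fintype ι] {V : Type} [AddCommMonoid V] {K : ℕ}
    (s : Finset ι) (φ : (Fin (K + 1) → Finset ι) → V) :
    ∑ J with IsOrderedPartition J s, φ J =
      ∑ S ∈ s.powerset, ∑ J : Fin K → Finset ι with IsOrderedPartition J (s \ S),
        φ (Fin.cons S J) := by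
  rw [Finset.sum_filter, ← (Fin.consEquiv fun _ => Finset ι).sum_comp, Fintype.sum_prod_type,
    ← Finset.sum_subset (Finset.subset_univ s.powerset)]
  · refine Finset.sum_congr rfl fun S hS => ?_
    rw [Finset.sum_filter]
    refine Finset.sum_congr rfl fun J _ => ?_
    simp [Fin.consEquiv, isOrderedPartition_cons, Finset.mem_powerset.1 hS]
  · intro S _ hS
    refine Finset.sum_eq_zero fun J _ => if_neg ?_
    rw [Finset.mem_powerset] at hS
    simp [Fin.consEquiv, isOrderedPartition_cons, hS]

open Classical in
theorem sum_isOrderedPartition_univ [Fintype ι] {V : Type} [AddCommMonoid V] {K : ℕ}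
    (φ : (Fin K → Finset ι) → V) :
    ∑ J with IsOrderedPartition J Finset.univ, φ J =
      ∑ P : ι → Fin K, φ fun j => Finset.univ.filter fun k => P k = j := by
  symm
  refine Finset.sum_nbij (fun P j => Finset.univ.filter fun k => P k = j) ?_ ?_ ?_ fun _ _ => ?_
  · intro P _
    refine Finset.mem_filter.2 ⟨Finset.mem_univ _, fun i j hij => ?_, ?_⟩
    · exact Finset.disjoint_filter.2 fun k _ hi hj => hij (hi.symm.trans hj)
    · ext k; simp
  · intro P _ Q _ hPQ
    funext k
    have : k ∈ Finset.univ.filter fun l => Q l = P k := by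
      simpa using (Finset.ext_iff.1 (congrFun hPQ (P k)) k).1 (by simp)
    exact (Finset.mem_filter.1 this).2.symm
  · intro J hJ
    obtain ⟨hd, hu⟩ := (Finset.mem_filter.1 (Finset.mem_coe.1 hJ)).2
    have hex : ∀ k, ∃ j, k ∈ J j := fun k => by
      simpa using Finset.ext_iff.1 hu k
    choose P hP using hex
    refine ⟨P, Finset.mem_coe.2 (Finset.mem_univ _), ?_⟩
    funext j
    ext k
    simp only [Finset.mem_filter, Finset.mem_univ, true_and]
    refine ⟨fun h => h ▸ hP k, fun h => ?_⟩
    by_contra hne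
    exact Finset.disjoint_left.1 (hd hne) (hP k) h
  · rfl

end Partition

section Multicomponent

variable {ι : Type} [LinearOrder ι]

/-- The coefficient of an ordered partition `J` in the expansion of a Bethe vector. -/
def partitionCoeff {K : ℕ} (a d : Fin K → ℂ → ℂ) (lam : ι → ℂ) (J : Fin K → Finset ι) : ℂ :=
  ∏ i : Fin K, ∏ j ∈ Finset.univ.filter (fun j : Fin K => i < j),
    ((∏ k ∈ J j, a i (lam k)) * (∏ k ∈ J i, d j (lam k)) *
      (∏ k ∈ J i, ∏ l ∈ J j, fXXX (lam k) (lam l)))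

theorem partitionCoeff_cons {K : ℕ} (a d : Fin (K + 1) → ℂ → ℂ) (lam : ι → ℂ) (S s : Finset ι)
    {J : Fin K → Finset ι} (hJ : IsOrderedPartition J s) :
    partitionCoeff a d lam (Fin.cons S J) =
      ((∏ k ∈ s, a 0 (lam k)) * (∏ k ∈ S, ∏ j : Fin K, d j.succ (lam k)) *
        ∏ k ∈ S, ∏ l ∈ s, fXXX (lam k) (lam l)) *
      partitionCoeff (fun j => a j.succ) (fun j => d j.succ) lam J := by
  have hfib : ∀ h : ι → ℂ, ∏ k ∈ s, h k = ∏ j, ∏ k ∈ J j, h k := fun h => by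
    rw [← hJ.2, Finset.prod_biUnion fun i _ j _ hij => hJ.1 hij]
  simp only [partitionCoeff, Finset.prod_filter, Fin.prod_univ_succ, Fin.cons_zero, Fin.cons_succ,
    Fin.succ_lt_succ_iff, Fin.succ_pos, Fin.not_lt_zero, if_true, if_false, one_mul]
  congr 1
  rw [hfib, Finset.prod_comm (s := S) (t := Finset.univ), Finset.prod_mul_distrib,
    Finset.prod_mul_distrib, Finset.prod_comm (s := S) (t := s), hfib]
  congr 1
  exact Finset.prod_congr rfl fun j _ => Finset.prod_comm

open Classical in
theorem finsetOpProd_ofFn_prod [Fintype ι] {Λ : Set ℂ} {v : H} {lam : ι → ℂ}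
    (hlam : ∀ i, lam i ∈ Λ) (hinj : Function.Injective lam) {K : ℕ}
    {T : Fin K → ℂ → Matrix (Fin 2) (Fin 2) (EndH H)} {a d : Fin K → ℂ → ℂ}
    (hT : ∀ j, IsHighestWeightXXX Λ (T j) v (a j) (d j))
    (hcomm : ∀ i j : Fin K, i ≠ j → ∀ l m : ℂ, l ∈ Λ → m ∈ Λ →
      ∀ p q r s : Fin 2, Commute (T i l p q) (T j m r s)) (s : Finset ι) :
    finsetOpProd s (fun i => (List.ofFn fun j => T j (lam i)).prod 0 1) v =
      ∑ J with IsOrderedPartition J s, partitionCoeff a d lam J •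
        (List.ofFn fun j => finsetOpProd (J j) fun k => T j (lam k) 0 1).prod v := by
  induction K generalizing s with
  | zero =>
    rcases s.eq_empty_or_nonempty with rfl | ⟨m, hm⟩
    · have : ∀ J : Fin 0 → Finset ι, IsOrderedPartition J ∅ := fun J =>
        ⟨fun i => i.elim0, by simp⟩
      rw [Finset.sum_filter, Fintype.sum_unique, if_pos (this _)]
      simp [finsetOpProd_empty, partitionCoeff]
    · have : ∀ J : Fin 0 → Finset ι, ¬ IsOrderedPartition J s := fun J h => by
        simp [← h.2] at hm
      rw [← Finset.insert_erase hm, finsetOpProd_insert (by simp) (Finset.notMem_erase m s),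
        Finset.insert_erase hm, Finset.sum_filter, Fintype.sum_unique, if_neg (this _)]
      simp
  | succ K ih =>
    have hcomm' : ∀ i j : Fin K, i ≠ j → ∀ l m : ℂ, l ∈ Λ → m ∈ Λ →
        ∀ p q r s : Fin 2, Commute (T i.succ l p q) (T j.succ m r s) :=
      fun i j hij => hcomm _ _ (Fin.succ_injective K |>.ne hij)
    have hU := IsHighestWeightXXX.ofFn_prod (fun j => hT j.succ) hcomm'
    have hTU : ∀ i j p q r s, Commute (T 0 (lam i) p q)
        ((List.ofFn fun n : Fin K => T n.succ (lam j)).prod r s) := fun i j p q =>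
      commute_ofFn_prod_apply _ fun k =>
        hcomm 0 k.succ (Fin.succ_ne_zero k).symm _ _ (hlam i) (hlam j) p q
    have hB := fun i j => (IsHighestWeightXXX.ofFn_prod hT hcomm).rtt.commute_B (hlam i) (hlam j)
    simp only [List.ofFn_succ, List.prod_cons, Matrix.mul_apply, Fin.sum_univ_two] at hB ⊢
    rw [finsetOpProd_two_component (f := fun i j => fXXX (lam i) (lam j))
      (g := fun i j => gXXX (lam i) (lam j))
      (fun i j => (hT 0).rtt.commute_B (hlam i) (hlam j))
      (fun i j => hU.rtt.commute_B (hlam i) (hlam j)) hB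
      (fun i j => hTU i j _ _ _ _) (fun i j => hTU i j _ _ _ _) (fun i j => hTU i j _ _ _ _)
      (fun i j hij => (hT 0).rtt.A_mul_B (hlam i) (hlam j) (hinj.ne hij))
      (fun i j hij => hU.rtt.D_mul_B (hlam i) (hlam j) (hinj.ne hij))
      (fun i j => gXXX_antisymm _ _)
      (fun i j k hij hik hjk => fXXX_mul_gXXX_add (hinj.ne hij) (hinj.ne hik) (hinj.ne hjk))
      (fun i j k hij hik hjk => fXXX_mul_gXXX_add' (hinj.ne hij) (hinj.ne hik) (hinj.ne hjk))
      (fun i => (hT 0).apply_A _ (hlam i)) (fun i => hU.apply_D _ (hlam i)),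
      sum_isOrderedPartition_succ]
    refine Finset.sum_congr rfl fun S _ => ?_
    rw [ih (fun j => hT j.succ) hcomm', map_sum, Finset.smul_sum]
    refine Finset.sum_congr rfl fun J hJ => ?_
    rw [map_smul, smul_smul, partitionCoeff_cons a d lam S _ (Finset.mem_filter.1 hJ).2]
    simp

end Multicomponent

/-- multi-component model, XXX case: the formal Bethe vector of the
full model expressed via its `K` components.  Ordered partitions `(J₁, …, J_K)` of
`{1,…,M}` are encoded as maps `P : Fin M → Fin K`, with `Jⱼ = P⁻¹(j)`. -/
theorem multi_component_Bethe_vectors_XXX {H : Type} [AddCommGroup H] [Module ℂ H]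
    (K : ℕ) (hK : 1 ≤ K) (Λ : Set ℂ)
    (T : Fin K → ℂ → Matrix (Fin 2) (Fin 2) (EndH H))
    (hRTT : ∀ j : Fin K, SatisfiesRTT Λ (fun lam mu => lam ≠ mu) RXXX (T j))
    (hcomm : ∀ i j : Fin K, i ≠ j → ∀ lam mu : ℂ, lam ∈ Λ → mu ∈ Λ →
      ∀ a b c d : Fin 2, Commute (T i lam a b) (T j mu c d))
    (v0 : H) (hv0 : v0 ≠ 0) (a d : Fin K → ℂ → ℂ)
    (hA : ∀ (j : Fin K) (lam : ℂ), lam ∈ Λ → T j lam 0 0 v0 = a j lam • v0)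
    (hD : ∀ (j : Fin K) (lam : ℂ), lam ∈ Λ → T j lam 1 1 v0 = d j lam • v0)
    (hC : ∀ (j : Fin K) (lam : ℂ), lam ∈ Λ → T j lam 1 0 v0 = 0)
    (M : ℕ) (lam : Fin M → ℂ) (hlam : ∀ i, lam i ∈ Λ)
    (hdist : Function.Injective lam) :
    ((List.ofFn (fun i : Fin M =>
        (List.ofFn (fun j : Fin K => T j (lam i))).prod 0 1)).prod) v0
      = ∑ P : Fin M → Fin K,
          ((∏ i : Fin K, ∏ j ∈ Finset.univ.filter (fun j : Fin K => i < j),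
              ((∏ k ∈ Finset.univ.filter (fun k : Fin M => P k = j), a i (lam k)) *
                (∏ k ∈ Finset.univ.filter (fun k : Fin M => P k = i), d j (lam k)) *
                (∏ k ∈ Finset.univ.filter (fun k : Fin M => P k = i),
                  ∏ l ∈ Finset.univ.filter (fun l : Fin M => P l = j),
                    fXXX (lam k) (lam l)))) •
            (((List.ofFn (fun j : Fin K =>
                finsetOpProd (Finset.univ.filter (fun k : Fin M => P k = j))
                  (fun k => T j (lam k) 0 1))).prod) v0)) := by
  have hT : ∀ j, IsHighestWeightXXX Λ (T j) v0 (a j) (d j) := fun j =>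
    ⟨hRTT j, hA j, hD j, hC j⟩
  rw [← finsetOpProd_univ, finsetOpProd_ofFn_prod hlam hdist hT hcomm,
    sum_isOrderedPartition_univ]
  rfl

end
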